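/- For all τ in the complex upper half-plane ℍ, one has 48 + Δ(τ/2)/Δ(τ) − Δ(τ)²/(Δ(τ/2)·Δ(2τ)) + 4096·Δ(2τ)/Δ(τ) = 0. (This is the eta-product identity 2χ_g − η_{-g}(τ/2)/η_{-g}(τ) + η_g(τ/2)/η_g(τ) + C_{-g}·η_{-g}(τ) − C_g·η_g(τ) = 0 in the case that g is the identity element of the Conway group, where χ_e = 24, C_e = 0, C_{-e} = 4096, η_e(τ) = Δ(τ) and η_{-e}(τ) = Δ(2τ)/Δ(τ).) -/

import Mathlib

noncomputable section

open Complex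

/-- `2πi`. -/
def twoPiI : ℂ := 2 * Real.pi * Complex.I

/-- `q = e^{2πiτ}`. -/
def qq (τ : ℂ) : ℂ := Complex.exp (twoPiI * τ)

/-- `y = e^{2πiz}`. -/
def yy (z : ℂ) : ℂ := Complex.exp (twoPiI * z)

/-- Jacobi theta function `ϑ₁`. -/
def th1 (τ z : ℂ) : ℂ :=
  -Complex.I * ∑' n : ℤ, (-1 : ℂ) ^ n *
    Complex.exp (twoPiI * (((n : ℂ) + 1/2) * z + ((n : ℂ) + 1/2) ^ 2 / 2 * τ))

/-- Jacobi theta function `ϑ₂`. -/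
def th2 (τ z : ℂ) : ℂ :=
  ∑' n : ℤ, Complex.exp (twoPiI * (((n : ℂ) + 1/2) * z + ((n : ℂ) + 1/2) ^ 2 / 2 * τ))

/-- Jacobi theta function `ϑ₃`. -/
def th3 (τ z : ℂ) : ℂ :=
  ∑' n : ℤ, Complex.exp (twoPiI * ((n : ℂ) * z + (n : ℂ) ^ 2 / 2 * τ))

/-- Jacobi theta function `ϑ₄`. -/
def th4 (τ z : ℂ) : ℂ :=
  ∑' n : ℤ, (-1 : ℂ) ^ n * Complex.exp (twoPiI * ((n : ℂ) * z + (n : ℂ) ^ 2 / 2 * τ))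

/-- The Dedekind eta function `η(τ) = q^{1/24} ∏_{n≥1} (1 - qⁿ)`. -/
def etaF (τ : ℂ) : ℂ :=
  Complex.exp (twoPiI * τ / 24) * ∏' n : ℕ, (1 - qq τ ^ (n + 1))

/-- The quasimodular Eisenstein series `E₂(τ) = 1 - 24 ∑_{n≥1} σ₁(n) qⁿ`. -/
def E2 (τ : ℂ) : ℂ :=
  1 - 24 * ∑' n : ℕ, (∑ d ∈ Nat.divisors (n + 1), (d : ℂ)) * qq τ ^ (n + 1)

/-- `Λ_N(τ) = (N/24)(N E₂(Nτ) - E₂(τ))`. -/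
def Lam (N : ℕ) (τ : ℂ) : ℂ := (N : ℂ) / 24 * ((N : ℂ) * E2 ((N : ℂ) * τ) - E2 τ)

/-- The weak Jacobi form `φ_{0,1}`. -/
def phi01 (τ z : ℂ) : ℂ :=
  4 * (th2 τ z ^ 2 / th2 τ 0 ^ 2 + th3 τ z ^ 2 / th3 τ 0 ^ 2 + th4 τ z ^ 2 / th4 τ 0 ^ 2)

/-- The weak Jacobi form `φ_{-2,1}`. -/
def phim21 (τ z : ℂ) : ℂ := -(th1 τ z ^ 2) / etaF τ ^ 6

/-- `Δ(τ) = η(τ)²⁴`. -/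
def Delta (τ : ℂ) : ℂ := etaF τ ^ 24

lemma etaF_eq_eta (τ : ℂ) : etaF τ = ModularForm.eta τ := by
  simp [etaF, ModularForm.eta, ModularForm.eta_q, Function.Periodic.qParam, qq, twoPiI]

/-- The Euler product `∏_{n≥1} (1 - qⁿ)`. -/
def eulerProd (q : ℂ) : ℂ := ∏' n : ℕ, (1 - q ^ (n + 1))

lemma Delta_eq_mul_eulerProd (τ : ℂ) : Delta τ = qq τ * eulerProd (qq τ) ^ 24 := by
  rw [Delta, etaF, mul_pow, eulerProd, ← Complex.exp_nat_mul, qq]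
  congr 2
  push_cast
  ring

lemma qq_add_one (τ : ℂ) : qq (τ + 1) = qq τ := by
  simp [qq, twoPiI, mul_add, Complex.exp_add]

lemma qq_add_half (τ : ℂ) : qq (τ + 1 / 2) = -qq τ := by
  have h : twoPiI * (1 / 2) = Real.pi * I := by rw [twoPiI]; ring
  rw [qq, mul_add, Complex.exp_add, h, Complex.exp_pi_mul_I, qq]
  ring

lemma qq_nat_mul (n : ℕ) (τ : ℂ) : qq (n * τ) = qq τ ^ n := by
  rw [qq, qq, ← Complex.exp_nat_mul]
  ring_nf

lemma norm_qq_lt_one {τ : ℂ} (hτ : 0 < τ.im) : ‖qq τ‖ < 1 :=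
  UpperHalfPlane.norm_exp_two_pi_I_lt_one ⟨τ, hτ⟩

lemma exists_qq_eq {q : ℂ} (hq0 : q ≠ 0) (hq : ‖q‖ < 1) : ∃ τ : ℂ, 0 < τ.im ∧ qq τ = q := by
  refine ⟨Function.Periodic.invQParam 1 q,
    Function.Periodic.im_invQParam_pos_of_norm_lt_one one_pos hq hq0, ?_⟩
  simpa [Function.Periodic.qParam, qq, twoPiI] using
    Function.Periodic.qParam_right_inv one_ne_zero hq0

lemma Delta_ne_zero {τ : ℂ} (hτ : 0 < τ.im) : Delta τ ≠ 0 := by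
  rw [Delta, etaF_eq_eta]
  exact pow_ne_zero _ (ModularForm.eta_ne_zero hτ)

lemma differentiableAt_Delta {τ : ℂ} (hτ : 0 < τ.im) : DifferentiableAt ℂ Delta τ := by
  have h : Delta = fun z => ModularForm.eta z ^ 24 := by
    ext z
    rw [Delta, etaF_eq_eta]
  rw [h]
  exact (ModularForm.differentiableAt_eta_of_mem_upperHalfPlaneSet hτ).pow 24

lemma Delta_add_one (τ : ℂ) : Delta (τ + 1) = Delta τ := by
  simp only [Delta_eq_mul_eulerProd, qq_add_one]

lemma Delta_neg_one_div {τ : ℂ} (hτ : 0 < τ.im) : Delta (-1 / τ) = τ ^ 12 * Delta τ := by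
  have h : ModularForm.eta (-1 / τ) = (sqrt I)⁻¹ * (sqrt τ * ModularForm.eta τ) :=
    ModularForm.eta_comp_eq_csqrt_I_inv hτ
  have hτ0 : τ ≠ 0 := by rintro rfl; simp at hτ
  have hs (z : ℂ) (hz : z ≠ 0) : sqrt z ^ 24 = z ^ 12 := by
    rw [sqrt_eq_exp hz, ← Complex.exp_nat_mul]
    ring_nf
    rw [show Complex.log z * 12 = (12 : ℕ) * Complex.log z by push_cast; ring,
      Complex.exp_nat_mul, Complex.exp_log hz]
  have hI : (I : ℂ) ^ 12 = 1 := by rw [show 12 = 4 * 3 by norm_num, pow_mul, I_pow_four, one_pow]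
  rw [Delta, Delta, etaF_eq_eta, etaF_eq_eta, h, mul_pow, mul_pow, inv_pow, hs _ I_ne_zero,
    hs _ hτ0, hI]
  simp

lemma Delta_smul_half {w : ℂ} (hw : 0 < w.im) :
    Delta ((w - 1) / (2 * w - 1)) = (2 * w - 1) ^ 12 * Delta w := by
  have h1 : 0 < (w - 1).im := by simpa using hw
  have hne : w - 1 ≠ 0 := by intro h; rw [h] at h1; simp at h1
  have hne2 : 2 * w - 1 ≠ 0 := by
    intro h
    have := congrArg Complex.im h
    simp at this
    exact hw.ne' this
  have h2 : 0 < (-1 / (w - 1)).im := by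
    simpa using UpperHalfPlane.im_pnat_div_pos 1 ⟨w - 1, h1⟩
  have h3 : 0 < (-1 / (w - 1) - 1 - 1).im := by simpa using h2
  have e : (w - 1) / (2 * w - 1) = -1 / (-1 / (w - 1) - 1 - 1) := by
    have : -1 / (w - 1) - 1 - 1 = -(2 * w - 1) / (w - 1) := by field_simp; ring
    rw [this]
    field_simp
  have hsub (z : ℂ) : Delta (z - 1) = Delta z := by
    rw [← Delta_add_one (z - 1), sub_add_cancel]
  rw [e, Delta_neg_one_div h3, hsub, hsub, Delta_neg_one_div h1, hsub]
  have : -1 / (w - 1) - 1 - 1 = -(2 * w - 1) / (w - 1) := by field_simp; ring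
  rw [this]
  field_simp

lemma eulerProd_differentiableOn : DifferentiableOn ℂ eulerProd (Metric.ball 0 1) :=
  ModularForm.differentiableOn_tprod_one_sub_pow

lemma eulerProd_zero : eulerProd 0 = 1 := by simp [eulerProd]

lemma hasDerivAt_eulerProd_zero : HasDerivAt eulerProd (-1) 0 := by
  have h0 : (0 : ℂ) ∈ Metric.ball (0 : ℂ) 1 := by simp
  have hl (i : ℕ) : logDeriv (fun q : ℂ => 1 - q ^ (i + 1)) 0 = if i = 0 then -1 else 0 := by
    rcases i with _ | i <;> simp [logDeriv]
  have h := logDeriv_tprod_eq_tsum Metric.isOpen_ball h0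
    (f := fun (n : ℕ) (q : ℂ) => 1 - q ^ (n + 1)) (by simp) (by fun_prop)
    (by simp_rw [hl]; exact (hasSum_ite_eq 0 (-1 : ℂ)).summable)
    ModularForm.multipliableLocallyUniformlyOn_one_sub_pow (by simp)
  simp_rw [hl, tsum_ite_eq] at h
  have hd := (eulerProd_differentiableOn.differentiableAt
    (Metric.isOpen_ball.mem_nhds h0)).hasDerivAt
  have hlog : logDeriv eulerProd 0 = -1 := h
  rw [logDeriv_apply, eulerProd_zero, div_one] at hlog
  rwa [hlog] at hd

/-- The product `∏_{n odd} (1 - qⁿ)`. -/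
def oddEulerProd (q : ℂ) : ℂ := ∏' n : ℕ, (1 - q ^ (2 * n + 1))

lemma multipliable_one_sub_pow_odd {q : ℂ} (hq : ‖q‖ < 1) :
    Multipliable fun n : ℕ => 1 - q ^ (2 * n + 1) := by
  simp_rw [sub_eq_add_neg]
  apply multipliable_one_add_of_summable
  simpa [Function.comp_def] using
    (summable_geometric_of_lt_one (norm_nonneg q) hq).comp_injective
    (i := fun n : ℕ => 2 * n + 1) (fun a b h => by simpa using h)

lemma norm_sq_lt_one {q : ℂ} (hq : ‖q‖ < 1) : ‖q ^ 2‖ < 1 := by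
  rw [norm_pow]
  exact pow_lt_one₀ (norm_nonneg q) hq two_ne_zero

lemma oddEulerProd_mul_eulerProd_sq {q : ℂ} (hq : ‖q‖ < 1) :
    oddEulerProd q * eulerProd (q ^ 2) = eulerProd q := by
  have h2 : (fun n : ℕ => 1 - q ^ (2 * n + 1 + 1)) = fun n => 1 - (q ^ 2) ^ (n + 1) := by
    ext n
    rw [← pow_mul]
    ring_nf
  have h := tprod_even_mul_odd (f := fun n : ℕ => 1 - q ^ (n + 1))
    (multipliable_one_sub_pow_odd hq)
    (h2 ▸ ModularForm.multipliable_one_sub_pow (norm_sq_lt_one hq))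
  rw [h2] at h
  exact h

lemma oddEulerProd_mul_neg {q : ℂ} (hq : ‖q‖ < 1) :
    oddEulerProd q * oddEulerProd (-q) = oddEulerProd (q ^ 2) := by
  rw [oddEulerProd, oddEulerProd, oddEulerProd, ← (multipliable_one_sub_pow_odd hq).tprod_mul
    (multipliable_one_sub_pow_odd (by simpa using hq))]
  congr 1
  ext n
  rw [Odd.neg_pow ⟨n, rfl⟩]
  ring

lemma eulerProd_mul_neg_mul_pow_four {q : ℂ} (hq : ‖q‖ < 1) :
    eulerProd q * eulerProd (-q) * eulerProd (q ^ 4) = eulerProd (q ^ 2) ^ 3 := by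
  have h1 := oddEulerProd_mul_eulerProd_sq hq
  have h2 := oddEulerProd_mul_eulerProd_sq (q := -q) (by simpa using hq)
  have h3 := oddEulerProd_mul_eulerProd_sq (norm_sq_lt_one hq)
  rw [neg_sq] at h2
  rw [← pow_mul] at h3
  rw [← h1, ← h2]
  linear_combination eulerProd (q ^ 2) ^ 2 * eulerProd (q ^ 4) * oddEulerProd_mul_neg hq
    + eulerProd (q ^ 2) ^ 2 * h3

/-- Twice the image of `Δ` under the Hecke operator `T₂`. -/
def heckeDelta (τ : ℂ) : ℂ := Delta (τ / 2) + Delta ((τ + 1) / 2) + 4096 * Delta (2 * τ)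

/-- The expansion of `heckeDelta` in the variable `e^{πiτ}`. -/
def heckeSeries (x : ℂ) : ℂ :=
  x * eulerProd x ^ 24 - x * eulerProd (-x) ^ 24 + 4096 * (x ^ 4 * eulerProd (x ^ 4) ^ 24)

lemma qq_add_one_div_two (τ : ℂ) : qq ((τ + 1) / 2) = -qq (τ / 2) := by
  rw [add_div, qq_add_half]

lemma qq_two_mul (τ : ℂ) : qq (2 * τ) = qq (τ / 2) ^ 4 := by
  rw [← qq_nat_mul]
  congr 1
  push_cast
  ring

lemma qq_eq_qq_half_sq (τ : ℂ) : qq τ = qq (τ / 2) ^ 2 := by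
  rw [← qq_nat_mul]
  congr 1
  push_cast
  ring

lemma heckeDelta_eq_heckeSeries (τ : ℂ) : heckeDelta τ = heckeSeries (qq (τ / 2)) := by
  rw [heckeDelta, heckeSeries, Delta_eq_mul_eulerProd, Delta_eq_mul_eulerProd,
    Delta_eq_mul_eulerProd, qq_add_one_div_two, qq_two_mul]
  ring

lemma half_im_pos {τ : ℂ} (hτ : 0 < τ.im) : 0 < (τ / 2).im := by simpa using hτ

lemma Delta_half_mul_Delta_mul_Delta_two_mul {τ : ℂ} (hτ : 0 < τ.im) :
    Delta (τ / 2) * Delta ((τ + 1) / 2) * Delta (2 * τ) = -Delta τ ^ 3 := by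
  have h := eulerProd_mul_neg_mul_pow_four (norm_qq_lt_one (half_im_pos hτ))
  rw [Delta_eq_mul_eulerProd, Delta_eq_mul_eulerProd, Delta_eq_mul_eulerProd,
    Delta_eq_mul_eulerProd, qq_add_one_div_two, qq_two_mul, qq_eq_qq_half_sq τ]
  set x := qq (τ / 2)
  calc _ = -x ^ 6 * (eulerProd x * eulerProd (-x) * eulerProd (x ^ 4)) ^ 24 := by ring
    _ = _ := by rw [h]; ring

lemma heckeDelta_add_one (τ : ℂ) : heckeDelta (τ + 1) = heckeDelta τ := by
  rw [heckeDelta, heckeDelta, show (τ + 1 + 1) / 2 = τ / 2 + 1 by ring,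
    show 2 * (τ + 1) = 2 * τ + 1 + 1 by ring, Delta_add_one, Delta_add_one, Delta_add_one]
  ring

lemma heckeDelta_neg_one_div {τ : ℂ} (hτ : 0 < τ.im) :
    heckeDelta (-1 / τ) = τ ^ 12 * heckeDelta τ := by
  have hτ0 : τ ≠ 0 := by rintro rfl; simp at hτ
  have h1 : -1 / τ / 2 = -1 / (2 * τ) := by field_simp
  have h2 : 2 * (-1 / τ) = -1 / (τ / 2) := by field_simp
  have h3 : (-1 / τ + 1) / 2 = ((τ + 1) / 2 - 1) / (2 * ((τ + 1) / 2) - 1) := by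
    rw [show 2 * ((τ + 1) / 2) - 1 = τ by ring]
    field_simp
    ring
  rw [heckeDelta, heckeDelta, h1, h2, h3, Delta_neg_one_div (by simpa using hτ),
    Delta_neg_one_div (half_im_pos hτ), Delta_smul_half (by simpa using hτ)]
  ring

lemma differentiableAt_heckeDelta {τ : ℂ} (hτ : 0 < τ.im) : DifferentiableAt ℂ heckeDelta τ := by
  refine .add (.add ?_ ?_) (.const_mul ?_ _)
  · exact (differentiableAt_Delta (half_im_pos hτ)).comp τ
      (f := fun z : ℂ => z / 2) (by fun_prop)
  · exact (differentiableAt_Delta (τ := (τ + 1) / 2) (by simpa using hτ)).comp τ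
      (f := fun z : ℂ => (z + 1) / 2) (by fun_prop)
  · exact (differentiableAt_Delta (τ := 2 * τ) (by simpa using hτ)).comp τ
      (f := fun z : ℂ => 2 * z) (by fun_prop)

lemma heckeSeries_continuousAt_zero : ContinuousAt heckeSeries 0 := by
  have h : ContinuousAt eulerProd 0 := hasDerivAt_eulerProd_zero.continuousAt
  have h1 : ContinuousAt (fun x => eulerProd (-x)) 0 :=
    ContinuousAt.comp (x := (0 : ℂ)) (g := eulerProd) (f := fun x => -x) (by simpa using h) (by fun_prop)
  have h2 : ContinuousAt (fun x => eulerProd (x ^ 4)) 0 :=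
    ContinuousAt.comp (x := (0 : ℂ)) (g := eulerProd) (f := fun x => x ^ 4) (by simpa using h) (by fun_prop)
  unfold heckeSeries
  fun_prop

open UpperHalfPlane in
lemma heckeDelta_isZeroAtImInfty : IsZeroAtImInfty fun τ : ℍ => heckeDelta τ := by
  have hx : Filter.Tendsto (fun τ : ℍ => qq ((τ : ℂ) / 2)) atImInfty (nhds 0) := by
    refine (qParam_tendsto_atImInfty two_pos).congr fun τ => ?_
    rw [Function.Periodic.qParam, qq, twoPiI]
    push_cast
    ring_nf
  have h := heckeSeries_continuousAt_zero.tendsto.comp hx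
  rw [show heckeSeries 0 = 0 by simp [heckeSeries]] at h
  exact h.congr fun τ => (heckeDelta_eq_heckeSeries τ).symm

open UpperHalfPlane ModularForm in
lemma heckeDelta_slash_T :
    ((fun τ : ℍ => heckeDelta τ) ∣[(12 : ℤ)] ModularGroup.T) = fun τ : ℍ => heckeDelta τ := by
  ext z
  rw [SL_slash_apply, modular_T_smul, ModularGroup.denom_apply]
  simp [ModularGroup.T, add_comm (1 : ℂ), heckeDelta_add_one]

open UpperHalfPlane ModularForm in
lemma heckeDelta_slash_S :
    ((fun τ : ℍ => heckeDelta τ) ∣[(12 : ℤ)] ModularGroup.S) = fun τ : ℍ => heckeDelta τ := by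
  ext z
  have h := heckeDelta_neg_one_div z.im_pos
  rw [neg_div, one_div] at h
  suffices heckeDelta (-(↑z)⁻¹) * ((z : ℂ) ^ 12)⁻¹ = heckeDelta z by
    rw [SL_slash_apply, UpperHalfPlane.modular_S_smul, ModularGroup.denom_S]
    rw [← inv_neg] at this
    rw [zpow_neg]
    exact_mod_cast this
  rw [h]
  field_simp [z.ne_zero]

open UpperHalfPlane MatrixGroups in
/-- `heckeDelta` as a cusp form of level one. -/
def heckeDeltaCuspForm : CuspForm 𝒮ℒ 12 where
  toFun τ := heckeDelta τ
  slash_action_eq' A hA := by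
    obtain ⟨A, rfl⟩ := hA
    exact SlashInvariantForm.slash_action_generators_SL2Z heckeDelta_slash_S heckeDelta_slash_T A
  holo' := by
    rw [UpperHalfPlane.mdifferentiable_iff]
    refine .congr (f := heckeDelta)
      (fun z hz => (differentiableAt_heckeDelta hz).differentiableWithinAt) fun z hz => ?_
    simp [ofComplex_apply_of_im_pos hz]
  zero_at_cusps' hc := by
    rw [Subgroup.IsArithmetic.isCusp_iff_isCusp_SL2Z] at hc
    rw [OnePoint.isZeroAt_iff_forall_SL2Z hc]
    intro γ _
    rw [SlashInvariantForm.slash_action_generators_SL2Z heckeDelta_slash_S heckeDelta_slash_T]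
    exact heckeDelta_isZeroAtImInfty

lemma exists_heckeDelta_eq_mul :
    ∃ c : ℂ, ∀ τ : ℂ, 0 < τ.im → heckeDelta τ = c * Delta τ := by
  obtain ⟨c, hc⟩ := CuspForm.exists_smul_discriminant_of_weight_eq_twelve heckeDeltaCuspForm
  refine ⟨c, fun τ hτ => ?_⟩
  have h := DFunLike.congr_fun hc (⟨τ, hτ⟩ : UpperHalfPlane)
  rw [Delta, etaF_eq_eta]
  exact h.symm

lemma eulerProd_eq_of_heckeDelta_eq_mul {c : ℂ} (hc : ∀ τ : ℂ, 0 < τ.im → heckeDelta τ = c * Delta τ)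
    {x : ℂ} (hx : ‖x‖ < 1) :
    eulerProd x ^ 24 - eulerProd (-x) ^ 24 + 4096 * (x ^ 3 * eulerProd (x ^ 4) ^ 24)
      = c * (x * eulerProd (x ^ 2) ^ 24) := by
  rcases eq_or_ne x 0 with rfl | hx0
  · simp
  · obtain ⟨τ, hτ, rfl⟩ := exists_qq_eq hx0 hx
    have h := hc (2 * τ) (by simpa using hτ)
    rw [heckeDelta_eq_heckeSeries, Delta_eq_mul_eulerProd, qq_eq_qq_half_sq (2 * τ),
      mul_div_cancel_left₀ τ two_ne_zero, heckeSeries] at h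
    apply mul_left_cancel₀ hx0
    linear_combination h

lemma heckeDelta_eq {τ : ℂ} (hτ : 0 < τ.im) : heckeDelta τ = -48 * Delta τ := by
  obtain ⟨c, hc⟩ := exists_heckeDelta_eq_mul
  suffices c = -48 by rw [hc τ hτ, this]
  have h := hasDerivAt_eulerProd_zero
  have hn : HasDerivAt (fun x => eulerProd (-x)) 1 0 := by
    have := HasDerivAt.comp (0 : ℂ) (h₂ := eulerProd) (h := fun x => -x) (by simpa using h)
      (hasDerivAt_neg 0)
    simpa [Function.comp_def] using this
  have hk (k : ℕ) (hk : 2 ≤ k) : HasDerivAt (fun x => eulerProd (x ^ k)) 0 0 := by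
    have := HasDerivAt.comp (0 : ℂ) (h₂ := eulerProd) (h := fun x => x ^ k)
      (by rw [zero_pow (by omega)]; exact h) (hasDerivAt_pow k 0)
    rw [zero_pow (by omega : k - 1 ≠ 0), mul_zero, mul_zero] at this
    exact this
  have hL := ((h.fun_pow 24).sub (hn.fun_pow 24)).add
    (((hasDerivAt_pow 3 (0 : ℂ)).mul ((hk 4 (by norm_num)).fun_pow 24)).const_mul 4096)
  have hR := ((hasDerivAt_id (0 : ℂ)).mul ((hk 2 le_rfl).fun_pow 24)).const_mul c
  have hLR := hR.congr_of_eventuallyEq (f₁ := _) (by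
    filter_upwards [Metric.ball_mem_nhds (0 : ℂ) one_pos] with x hx
    exact eulerProd_eq_of_heckeDelta_eq_mul hc (by simpa using hx))
  have := hL.unique hLR
  norm_num [eulerProd_zero] at this
  exact this.symm

/-- The eta-product identity for the identity element of the Conway group:
`48 + Δ(τ/2)/Δ(τ) − Δ(τ)²/(Δ(τ/2)·Δ(2τ)) + 4096·Δ(2τ)/Δ(τ) = 0`. -/
theorem eta_identity_identity_element :
    ∀ τ : ℂ, 0 < τ.im →
      48 + Delta (τ / 2) / Delta τ - Delta τ ^ 2 / (Delta (τ / 2) * Delta (2 * τ))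
        + 4096 * Delta (2 * τ) / Delta τ = 0 := by
  intro τ hτ
  have hA := Delta_ne_zero (half_im_pos hτ)
  have hB := Delta_ne_zero hτ
  have hC : Delta (2 * τ) ≠ 0 := Delta_ne_zero (by simpa using hτ)
  have hprod := Delta_half_mul_Delta_mul_Delta_two_mul hτ
  have hsum := heckeDelta_eq hτ
  rw [heckeDelta] at hsum
  generalize Delta (2 * τ) = C at *
  field_simp
  linear_combination Delta (τ / 2) * C * hsum - hprod
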